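/- arXiv:1207.3732 — 4 statements merged into one kernel-verified Lean document; each statement's English description precedes it below -/
import Mathlib

section
/- For every network (finite connected simple undirected graph G = (V,E) with a distinguished destination vertex d), there exists a 1-resilient forwarding pattern. -/
open SimpleGraph

/-- A forwarding pattern on a network `(G, d)`: each vertex `v` maps an incoming edge
`e ∈ E_v` and a set `T` of live incident edges to an outgoing edge in `T` or to `none`
(no rule); the destination `d` has no forwarding rules. -/
structure FwdPattern {V : Type*} (G : SimpleGraph V) (d : V) where
  rule : V → Sym2 V → Set (Sym2 V) → Option (Sym2 V)
  rule_mem : ∀ v e T e', rule v e T = some e' → e' ∈ T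
  rule_dest : ∀ e T, rule d e T = none

/-- `p 0, p 1, ..., p n` is a forwarding path under failure set `F`: a walk in
`H^F = G \ F` in which every two consecutive edges obey the forwarding rules
(with live sets `E_v \ F`). -/
def IsFwdPath {V : Type*} (G : SimpleGraph V) (d : V) (fp : FwdPattern G d)
    (F : Set (Sym2 V)) (p : ℕ → V) (n : ℕ) : Prop :=
  (∀ k, k < n → (G.deleteEdges F).Adj (p k) (p (k + 1))) ∧
  ∀ k, k + 2 ≤ n →
    fp.rule (p (k + 1)) s(p k, p (k + 1)) (G.incidenceSet (p (k + 1)) \ F) =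
      some s(p (k + 1), p (k + 2))

/-- Vertex `i` has a forwarding path to the destination `d` under failure set `F`. -/
def HasFwdPathTo {V : Type*} (G : SimpleGraph V) (d : V) (fp : FwdPattern G d)
    (F : Set (Sym2 V)) (i : V) : Prop :=
  ∃ p n, IsFwdPath G d fp F p n ∧ p 0 = i ∧ p n = d

/-- The walk `p 0, ..., p n` revisits a directed edge (it has a loop). -/
def RepeatsDirEdge {V : Type*} (p : ℕ → V) (n : ℕ) : Prop :=
  ∃ j k, j < k ∧ k < n ∧ p j = p k ∧ p (j + 1) = p (k + 1)

/-- The forwarding pattern `fp` is resilient under the particular failure set `F`: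
(1) every vertex with a path to `d` in `H^F` has a forwarding path to `d` in `H^F`, and
(2) every forwarding path in `H^F` is loop-free. -/
def ResilientUnder {V : Type*} (G : SimpleGraph V) (d : V) (fp : FwdPattern G d)
    (F : Set (Sym2 V)) : Prop :=
  (∀ i, (G.deleteEdges F).Reachable i d → HasFwdPathTo G d fp F i) ∧
  ∀ p n, IsFwdPath G d fp F p n → ¬ RepeatsDirEdge p n

/-- `t`-resilience: resilience under every failure set of at most `t` edges. -/
def IsResilient {V : Type*} (G : SimpleGraph V) (d : V) (fp : FwdPattern G d)
    (t : ℕ) : Prop :=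
  ∀ F : Finset (Sym2 V), ↑F ⊆ G.edgeSet → F.card ≤ t → ResilientUnder G d fp ↑F

/-- Perfect resilience: resilience under every failure set whatsoever. -/
def PerfectlyResilient {V : Type*} (G : SimpleGraph V) (d : V)
    (fp : FwdPattern G d) : Prop :=
  ∀ F : Set (Sym2 V), F ⊆ G.edgeSet → ResilientUnder G d fp F



/-- A spanning tree rooted at `d`, given by a parent map and a height function. -/
structure RTree {V : Type*} (G : SimpleGraph V) (d : V) where
  p : V → V
  h : V → ℕ
  pd : p d = d
  hd : h d = 0
  padj : ∀ v, v ≠ d → G.Adj v (p v)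
  ph : ∀ v, v ≠ d → h (p v) + 1 = h v

theorem exists_rtree {V : Type*} (G : SimpleGraph V) (d : V) (hG : G.Connected) :
    Nonempty (RTree G d) := by
  classical
  have key : ∀ v, ∃ w, (v = d → w = d) ∧
      (v ≠ d → G.Adj v w ∧ G.dist w d + 1 = G.dist v d) := by
    intro v
    by_cases hv : v = d
    · exact ⟨d, fun _ => rfl, fun h => absurd hv h⟩
    · obtain ⟨W, hW⟩ := hG.exists_walk_length_eq_dist v d
      cases W with
      | nil => exact absurd rfl hv
      | @cons _ w _ hadj q =>
        refine ⟨w, fun h => absurd h hv, fun _ => ⟨hadj, ?_⟩⟩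
        have h1 : G.dist w d ≤ q.length := dist_le q
        have h2 : G.dist v d ≤ G.dist w d + 1 := by
          obtain ⟨q', hq'⟩ := hG.exists_walk_length_eq_dist w d
          have := dist_le (Walk.cons hadj q')
          simp only [Walk.length_cons] at this
          omega
        simp only [Walk.length_cons] at hW
        omega
  choose p hp1 hp2 using key
  exact ⟨⟨p, fun v => G.dist v d, hp1 d rfl, dist_self, fun v hv => (hp2 v hv).1, fun v hv => (hp2 v hv).2⟩⟩

namespace RTree

variable {V : Type*} {G : SimpleGraph V} {d : V} (t : RTree G d)

/-- `x` lies in the subtree rooted at `u`. -/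
def Sub (x u : V) : Prop := ∃ k : ℕ, t.p^[k] x = u

theorem sub_refl (u : V) : t.Sub u u := ⟨0, rfl⟩

theorem sub_parent {x c : V} (hx : t.Sub x c) : t.Sub x (t.p c) := by
  obtain ⟨k, hk⟩ := hx
  exact ⟨k + 1, by rw [Function.iterate_succ_apply', hk]⟩

theorem sub_of_parent {x u : V} (hx : t.Sub (t.p x) u) : t.Sub x u := by
  obtain ⟨k, hk⟩ := hx
  exact ⟨k + 1, by rw [Function.iterate_succ_apply, hk]⟩

theorem parent_sub {x u : V} (hx : t.Sub x u) (hne : x ≠ u) : t.Sub (t.p x) u := by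
  obtain ⟨k, hk⟩ := hx
  cases k with
  | zero => exact absurd hk hne
  | succ k => exact ⟨k, by rwa [Function.iterate_succ_apply] at hk⟩

theorem exists_child {x u : V} (hx : t.Sub x u) (hne : x ≠ u) :
    ∃ c, t.p c = u ∧ t.Sub x c := by
  obtain ⟨k, hk⟩ := hx
  cases k with
  | zero => exact absurd hk hne
  | succ k => exact ⟨t.p^[k] x, by rwa [Function.iterate_succ_apply'] at hk, k, rfl⟩

theorem sub_d {u : V} (h : t.Sub d u) : u = d := by
  obtain ⟨k, hk⟩ := h
  rw [← hk]
  exact Function.iterate_fixed t.pd k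

theorem h_parent_le (x : V) : t.h (t.p x) ≤ t.h x := by
  by_cases hx : x = d
  · subst hx; rw [t.pd]
  · have := t.ph x hx; omega

theorem sub_h {x u : V} (h : t.Sub x u) : t.h u ≤ t.h x := by
  obtain ⟨k, hk⟩ := h
  subst hk
  induction k with
  | zero => exact le_rfl
  | succ k ih =>
    rw [Function.iterate_succ_apply']
    exact (t.h_parent_le _).trans ih

theorem not_sub_parent {u : V} (hu : u ≠ d) : ¬ t.Sub (t.p u) u := by
  intro h
  have := t.sub_h h
  have := t.ph u hu
  omega

/-- two parent edges agree only if the vertices agree -/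
theorem edge_inj {u v : V} (hu : u ≠ d) (hv : v ≠ d)
    (h : s(u, t.p u) = s(v, t.p v)) : u = v := by
  rw [Sym2.eq_iff] at h
  rcases h with h | ⟨h1, h2⟩
  · exact h.1
  · have a := t.ph u hu
    have b := t.ph v hv
    rw [h2] at a
    rw [← h1] at b
    omega

/-- The edge `x y` leaves the subtree at `u`, and it is not the parent edge of `u`. -/
def Exits (u x y : V) : Prop :=
  G.Adj x y ∧ t.Sub x u ∧ ¬ t.Sub y u ∧ ¬ (x = u ∧ y = t.p u)

open Classical in
/-- Escape edges, computed top-down with fuel. -/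
noncomputable def E : ℕ → V → Option (V × V)
  | 0, _ => none
  | n + 1, v =>
    if ∃ q, E n (t.p v) = some q ∧ t.Sub q.1 v then E n (t.p v)
    else if hq : ∃ q : V × V, t.Exits v q.1 q.2 then some hq.choose else none

/-- The escape edge of a vertex. -/
noncomputable def esc (v : V) : Option (V × V) := t.E (t.h v) v

theorem esc_d : t.esc d = none := by
  unfold esc
  rw [t.hd]
  rfl

open Classical in
theorem esc_ne {v : V} (hv : v ≠ d) : t.esc v =
    if ∃ q, t.esc (t.p v) = some q ∧ t.Sub q.1 v then t.esc (t.p v)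
    else if hq : ∃ q : V × V, t.Exits v q.1 q.2 then some hq.choose else none := by
  unfold esc
  rw [← t.ph v hv]
  rfl

theorem esc_child {c : V} {q : V × V} (hc : c ≠ d) (h : t.esc (t.p c) = some q)
    (hs : t.Sub q.1 c) : t.esc c = some q := by
  rw [t.esc_ne hc, if_pos ⟨q, h, hs⟩, h]

theorem esc_exists {v : V} {q : V × V} (hv : v ≠ d) (hq : t.Exits v q.1 q.2) :
    ∃ q, t.esc v = some q := by
  classical
  rw [t.esc_ne hv]
  have hq' : ∃ q : V × V, t.Exits v q.1 q.2 := ⟨q, hq⟩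
  split_ifs with h
  · obtain ⟨q, h1, _⟩ := h
    exact ⟨q, h1⟩
  · exact ⟨_, rfl⟩

theorem esc_exits (v : V) (q : V × V) (h : t.esc v = some q) : t.Exits v q.1 q.2 := by
  classical
  induction hn : t.h v generalizing v with
  | zero =>
    unfold esc at h
    rw [hn] at h
    simp [E] at h
  | succ n ih =>
    have hv : v ≠ d := by
      rintro rfl
      rw [t.hd] at hn
      omega
    have hph := t.ph v hv
    rw [t.esc_ne hv] at h
    split_ifs at h with h1 h2
    · obtain ⟨q', h3, h4⟩ := h1
      rw [h] at h3
      cases h3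
      obtain ⟨a, b, c, e⟩ := ih (t.p v) h (by omega)
      refine ⟨a, h4, fun hy => c (t.sub_parent hy), ?_⟩
      rintro ⟨_, hy⟩
      rw [hy] at c
      exact c (t.sub_refl _)
    · cases h
      exact h2.choose_spec

/-- Specification of the next vertex on the way to the escape edge. -/
def Nxt (v : V) (q : V × V) (w : V) : Prop :=
  (q.1 = v ∧ w = q.2) ∨ (w ≠ d ∧ t.p w = v ∧ t.Sub q.1 w)

theorem exists_nxt : ∃ nx : V → V, ∀ v q, t.esc v = some q → t.Nxt v q (nx v) := by
  classical
  have : ∀ v, ∃ w, ∀ q, t.esc v = some q → t.Nxt v q w := by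
    intro v
    cases hv : t.esc v with
    | none => exact ⟨v, by simp⟩
    | some q =>
      have hvd : v ≠ d := by
        rintro rfl
        rw [t.esc_d] at hv
        cases hv
      by_cases hx : q.1 = v
      · refine ⟨q.2, ?_⟩
        rintro _ ⟨⟩
        exact Or.inl ⟨hx, rfl⟩
      · obtain ⟨c, hc1, hc2⟩ := t.exists_child (t.esc_exits v q hv).2.1 hx
        refine ⟨c, ?_⟩
        rintro _ ⟨⟩
        refine Or.inr ⟨?_, hc1, hc2⟩
        rintro rfl
        exact hvd (hc1.symm.trans t.pd)
  choose nx hnx using this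
  exact ⟨nx, hnx⟩

open Classical in
/-- The forwarding pattern. -/
noncomputable def pat (nx : V → V) : FwdPattern G d where
  rule v e T :=
    if v = d then none
    else if e ≠ s(v, t.p v) ∧ s(v, t.p v) ∈ T then some s(v, t.p v)
    else if t.esc v ≠ none ∧ s(v, nx v) ∈ T then some s(v, nx v) else none
  rule_mem := by
    intro v e T e' h
    split_ifs at h with h1 h2 h3
    · cases h; exact h2.2
    · cases h; exact h3.2
  rule_dest := by simp

/-- `b` was entered from its parent -/
def Down (a b : V) : Prop := b ≠ d ∧ a = t.p b

/-- vertices cut off in the tree by the failures -/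
def S (F : Set (Sym2 V)) (v : V) : Prop := ∃ u, u ≠ d ∧ s(u, t.p u) ∈ F ∧ t.Sub v u

section fail
variable {F : Set (Sym2 V)} (hF : F.Subsingleton)

theorem S_parent {v : V} (h : t.S F v) (hl : s(v, t.p v) ∉ F) : t.S F (t.p v) := by
  obtain ⟨u, h1, h2, h3⟩ := h
  refine ⟨u, h1, h2, t.parent_sub h3 ?_⟩
  rintro rfl
  exact hl h2

theorem not_S_live {v : V} (h : ¬ t.S F v) (hv : v ≠ d) : s(v, t.p v) ∉ F :=
  fun hm => h ⟨v, hv, hm, t.sub_refl v⟩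

theorem not_S_parent {v : V} (h : ¬ t.S F v) : ¬ t.S F (t.p v) := by
  rintro ⟨u, h1, h2, h3⟩
  exact h ⟨u, h1, h2, t.sub_of_parent h3⟩

theorem not_S_d : ¬ t.S F d := by
  rintro ⟨u, h1, _, h3⟩
  exact h1 (t.sub_d h3)

include hF

theorem esc_not_S {v : V} {q : V × V} (hv : v ≠ d) (hf : s(v, t.p v) ∈ F)
    (h : t.esc v = some q) : ¬ t.S F q.2 := by
  rintro ⟨u, h1, h2, h3⟩
  have := t.edge_inj h1 hv (hF h2 hf)
  subst this
  exact (t.esc_exits u q h).2.2.1 h3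

theorem S_child_live {c : V} (hc : c ≠ d) (h : t.S F (t.p c)) : s(c, t.p c) ∉ F := by
  intro hm
  obtain ⟨u, h1, h2, h3⟩ := h
  have := t.edge_inj h1 hc (hF h2 hm)
  subst this
  exact t.not_sub_parent h1 h3

theorem cross_live {v : V} {q : V × V} (h : t.esc v = some q) (hv : q.1 = v)
    (hx : t.S F v) (hy : ¬ t.S F q.2) : s(v, q.2) ∉ F := by
  intro hm
  have hE := t.esc_exits v q h
  obtain ⟨u, h1, h2, h3⟩ := hx
  have he := hF hm h2
  rw [Sym2.eq_iff] at he
  rcases he with ⟨e1, e2⟩ | ⟨e1, e2⟩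
  · exact hE.2.2.2 ⟨hv, by rw [e2, e1]⟩
  · exact hy ⟨u, h1, h2, by rw [e2]; exact t.sub_refl u⟩

end fail

open Classical in
/-- The measure that decreases along forwarding. -/
noncomputable def mu (F : Set (Sym2 V)) (N : ℕ) (a b : V) : ℕ :=
  if t.Down a b then
    if ∃ q, t.esc b = some q ∧ ¬ t.S F q.2 then 2 * N - t.h b else 5 * N - t.h b
  else if t.S F b then 2 * N + 1 + t.h b else t.h b

theorem up_not_down {b : V} (hb : b ≠ d) : ¬ t.Down b (t.p b) := by
  rintro ⟨h1, h2⟩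
  have a := t.ph b hb
  have c := t.ph _ h1
  rw [← h2] at c
  omega

theorem cross_not_down {b : V} {q : V × V} (h : t.esc b = some q) : ¬ t.Down b q.2 := by
  rintro ⟨_, h2⟩
  have hE := t.esc_exits b q h
  apply hE.2.2.1
  apply t.sub_of_parent
  rw [← h2]
  exact t.sub_refl b

theorem not_down_edge {a b : V} (hb : b ≠ d) : s(a, b) ≠ s(b, t.p b) ↔ ¬ t.Down a b := by
  rw [not_iff_not]
  constructor
  · intro h
    rw [Sym2.eq_iff] at h
    rcases h with ⟨h1, h2⟩ | ⟨h1, _⟩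
    · have := t.ph b hb
      rw [← h2] at this
      omega
    · exact ⟨hb, h1⟩
  · rintro ⟨_, h⟩
    rw [h, Sym2.eq_swap]

theorem mu_decr {F : Set (Sym2 V)} (hF : F.Subsingleton) {N : ℕ} (hN : ∀ v, t.h v < N)
    {nx : V → V} (hnx : ∀ v q, t.esc v = some q → t.Nxt v q (nx v)) {a b c : V}
    (h : (t.pat nx).rule b s(a, b) (G.incidenceSet b \ F) = some s(b, c)) :
    t.mu F N b c < t.mu F N a b := by
  classical
  simp only [pat] at h
  have hNb := hN b
  have hNc := hN c
  split_ifs at h with h1 h2 h3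
  · -- going up
    have hc : t.p b = c := Sym2.congr_right.mp (Option.some.inj h)
    subst hc
    have hl : s(b, t.p b) ∉ F := h2.2.2
    have hd := (t.not_down_edge h1).1 h2.1
    have hd' := t.up_not_down h1
    have hph := t.ph b h1
    unfold mu
    rw [if_neg hd, if_neg hd']
    by_cases hS : t.S F b
    · rw [if_pos hS, if_pos (t.S_parent hS hl)]; omega
    · rw [if_neg hS, if_neg (t.not_S_parent hS)]; omega
  · have hc : nx b = c := Sym2.congr_right.mp (Option.some.inj h)
    subst hc
    obtain ⟨q, hq⟩ := Option.ne_none_iff_exists'.mp h3.1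
    have hE := t.esc_exits b q hq
    by_cases hd : t.Down a b
    · rcases hnx b q hq with ⟨e1, e2⟩ | ⟨e1, e2, e3⟩
      · rw [e2] at hNc ⊢
        unfold mu
        rw [if_pos hd, if_neg (t.cross_not_down hq)]
        by_cases hS : t.S F q.2
        · rw [if_pos hS, if_neg]
          · omega
          · rintro ⟨q', h5, h6⟩
            rw [hq] at h5
            cases h5
            exact h6 hS
        · rw [if_neg hS, if_pos ⟨q, hq, hS⟩]
          omega
      · have hc := t.esc_child (q := q) e1 (by rw [e2]; exact hq) e3
        have hph := t.ph _ e1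
        rw [e2] at hph
        have hd' : t.Down b (nx b) := ⟨e1, e2.symm⟩
        unfold mu
        rw [if_pos hd, if_pos hd', hc, hq]
        split_ifs <;> omega
    · have hb : s(b, t.p b) ∈ F := by
        by_contra hb
        exact h2 ⟨(t.not_down_edge h1).2 hd, ⟨(t.padj b h1), by simp⟩, hb⟩
      have hSb : t.S F b := ⟨b, h1, hb, t.sub_refl b⟩
      have hSq := t.esc_not_S hF h1 hb hq
      rcases hnx b q hq with ⟨e1, e2⟩ | ⟨e1, e2, e3⟩
      · rw [e2] at hNc ⊢
        unfold mu
        rw [if_neg hd, if_neg (t.cross_not_down hq), if_pos hSb, if_neg hSq]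
        omega
      · have hc := t.esc_child (q := q) e1 (by rw [e2]; exact hq) e3
        have hd' : t.Down b (nx b) := ⟨e1, e2.symm⟩
        unfold mu
        rw [if_neg hd, if_pos hd', if_pos hSb, if_pos ⟨q, hc, hSq⟩]
        omega

theorem loop_free {F : Set (Sym2 V)} (hF : F.Subsingleton) {N : ℕ} (hN : ∀ v, t.h v < N)
    {nx : V → V} (hnx : ∀ v q, t.esc v = some q → t.Nxt v q (nx v)) (p : ℕ → V) (n : ℕ)
    (hp : IsFwdPath G d (t.pat nx) F p n) : ¬ RepeatsDirEdge p n := by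
  rintro ⟨j, k, hjk, hkn, h1, h2⟩
  have step : ∀ i, i + 2 ≤ n →
      t.mu F N (p (i + 1)) (p (i + 2)) < t.mu F N (p i) (p (i + 1)) :=
    fun i hi => t.mu_decr hF hN hnx (hp.2 i hi)
  have all : ∀ m, j + m + 2 ≤ n →
      t.mu F N (p (j + m + 1)) (p (j + m + 2)) < t.mu F N (p j) (p (j + 1)) := by
    intro m
    induction m with
    | zero => intro hm; exact step j hm
    | succ m ih =>
      intro hm
      exact (step (j + m + 1) (by omega)).trans (ih (by omega))
  obtain ⟨m, rfl⟩ : ∃ m, k = j + m + 1 := ⟨k - j - 1, by omega⟩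
  have := all m (by omega)
  rw [h1, h2] at this
  exact lt_irrefl _ this

/-- The directed edge `a b` is live and forwarding from it reaches `d`. -/
def Del (fp : FwdPattern G d) (F : Set (Sym2 V)) (a b : V) : Prop :=
  ∃ p n, IsFwdPath G d fp F p (n + 1) ∧ p 0 = a ∧ p 1 = b ∧ p (n + 1) = d

theorem del_dest (fp : FwdPattern G d) {F : Set (Sym2 V)} {a : V}
    (h : G.Adj a d) (hF : s(a, d) ∉ F) : Del fp F a d := by
  refine ⟨fun k => Nat.casesOn k a (fun _ => d), 0, ⟨?_, ?_⟩, rfl, rfl, rfl⟩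
  · intro k hk
    obtain rfl : k = 0 := by omega
    simpa using ⟨h, hF⟩
  · intro k hk
    omega

theorem del_cons {fp : FwdPattern G d} {F : Set (Sym2 V)} {a b c : V}
    (h : G.Adj a b) (hF : s(a, b) ∉ F)
    (hr : fp.rule b s(a, b) (G.incidenceSet b \ F) = some s(b, c))
    (hd : Del fp F b c) : Del fp F a b := by
  obtain ⟨p, n, ⟨hp1, hp2⟩, h0, h1, hn⟩ := hd
  refine ⟨fun k => Nat.casesOn k a p, n + 1, ⟨?_, ?_⟩, rfl, h0, hn⟩
  · intro k hk
    cases k with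
    | zero => simpa [h0] using ⟨h, hF⟩
    | succ k => exact hp1 k (by omega)
  · intro k hk
    cases k with
    | zero => simpa [h0, h1] using hr
    | succ k => exact hp2 k (by omega)

theorem rule_up (nx : V → V) {F : Set (Sym2 V)} {a b : V} (hb : b ≠ d)
    (hd : ¬ t.Down a b) (hl : s(b, t.p b) ∉ F) :
    (t.pat nx).rule b s(a, b) (G.incidenceSet b \ F) = some s(b, t.p b) := by
  simp only [pat]
  rw [if_neg hb, if_pos]
  exact ⟨(t.not_down_edge hb).2 hd, ⟨t.padj b hb, by simp⟩, hl⟩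

theorem rule_nx (nx : V → V) {F : Set (Sym2 V)} {a b : V} (hb : b ≠ d)
    (hd : t.Down a b ∨ s(b, t.p b) ∈ F) {q : V × V} (hq : t.esc b = some q)
    (ha : G.Adj b (nx b)) (hl : s(b, nx b) ∉ F) :
    (t.pat nx).rule b s(a, b) (G.incidenceSet b \ F) = some s(b, nx b) := by
  simp only [pat]
  rw [if_neg hb, if_neg, if_pos]
  · exact ⟨by simp [hq], ⟨ha, by simp⟩, hl⟩
  · rintro ⟨h1, h2⟩
    rcases hd with hd | hd
    · exact (t.not_down_edge hb).1 h1 hd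
    · exact h2.2 hd

section deliver
variable {F : Set (Sym2 V)} {nx : V → V}

theorem del_safe (a b : V) (h : G.Adj a b) (hl : s(a, b) ∉ F) (hd : ¬ t.Down a b)
    (hS : ¬ t.S F b) : Del (t.pat nx) F a b := by
  induction hn : t.h b generalizing a b with
  | zero =>
    by_cases hb : b = d
    · subst hb; exact del_dest _ h hl
    · have := t.ph b hb; omega
  | succ n ih =>
    by_cases hb : b = d
    · subst hb; exact del_dest _ h hl
    · have hlb := t.not_S_live hS hb
      have hph := t.ph b hb
      exact del_cons h hl (t.rule_up nx hb hd hlb)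
        (ih b (t.p b) (t.padj b hb) hlb (t.up_not_down hb) (t.not_S_parent hS) (by omega))

/-- From a cut-off vertex with a useful escape edge, the next edge is live and either
crosses out or goes down. -/
theorem nx_step (hF : F.Subsingleton)
    (hnx : ∀ v q, t.esc v = some q → t.Nxt v q (nx v)) {b : V}
    (hSb : t.S F b) {q : V × V} (hq : t.esc b = some q) (hSq : ¬ t.S F q.2) :
    G.Adj b (nx b) ∧ s(b, nx b) ∉ F ∧
      ((¬ t.Down b (nx b) ∧ ¬ t.S F (nx b)) ∨
        (t.Down b (nx b) ∧ t.S F (nx b) ∧ t.esc (nx b) = some q)) := by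
  have hE := t.esc_exits b q hq
  rcases hnx b q hq with ⟨e1, e2⟩ | ⟨e1, e2, e3⟩
  · rw [e2]
    refine ⟨?_, t.cross_live hF hq e1 hSb hSq, Or.inl ⟨t.cross_not_down hq, hSq⟩⟩
    have := hE.1
    rwa [e1] at this
  · have hadj := t.padj _ e1
    have hlive := t.S_child_live hF e1 (by rw [e2]; exact hSb)
    rw [e2] at hadj hlive
    refine ⟨hadj.symm, by rwa [Sym2.eq_swap], Or.inr ⟨⟨e1, e2.symm⟩, ?_, ?_⟩⟩
    · obtain ⟨u, h1, h2, h3⟩ := hSb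
      exact ⟨u, h1, h2, t.sub_of_parent (by rw [e2]; exact h3)⟩
    · exact t.esc_child e1 (by rw [e2]; exact hq) e3

theorem del_down (hF : F.Subsingleton) {N : ℕ} (hN : ∀ v, t.h v < N)
    (hnx : ∀ v q, t.esc v = some q → t.Nxt v q (nx v)) (a b : V)
    (h : G.Adj a b) (hl : s(a, b) ∉ F) (hd : t.Down a b)
    (hS : t.S F b) {q : V × V} (hq : t.esc b = some q) (hSq : ¬ t.S F q.2) :
    Del (t.pat nx) F a b := by
  induction hn : N - t.h b generalizing a b with
  | zero => have := hN b; omega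
  | succ n ih =>
    obtain ⟨h1, h2, h3⟩ := t.nx_step hF hnx hS hq hSq
    refine del_cons h hl (t.rule_nx nx hd.1 (Or.inl hd) hq h1 h2) ?_
    rcases h3 with ⟨h3, h4⟩ | ⟨h3, h4, h5⟩
    · exact t.del_safe _ _ h1 h2 h3 h4
    · have hph := t.ph _ h3.1
      rw [← h3.2] at hph
      exact ih b (nx b) h1 h2 h3 h4 h5 (by omega)

theorem del_nx (hF : F.Subsingleton) {N : ℕ} (hN : ∀ v, t.h v < N)
    (hnx : ∀ v q, t.esc v = some q → t.Nxt v q (nx v)) {b : V}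
    (hS : t.S F b) {q : V × V} (hq : t.esc b = some q) (hSq : ¬ t.S F q.2) :
    Del (t.pat nx) F b (nx b) := by
  obtain ⟨h1, h2, h3⟩ := t.nx_step hF hnx hS hq hSq
  rcases h3 with ⟨h3, h4⟩ | ⟨h3, h4, h5⟩
  · exact t.del_safe _ _ h1 h2 h3 h4
  · exact t.del_down hF hN hnx _ _ h1 h2 h3 h4 h5 hSq

/-- If `u` lost its parent edge but still reaches `d`, it has an escape edge. -/
theorem exists_esc {u : V} (hu : u ≠ d) (hf : s(u, t.p u) ∈ F)
    (hr : (G.deleteEdges F).Reachable u d) : ∃ q, t.esc u = some q := by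
  obtain ⟨W⟩ := hr
  have key : ∀ (a b : V) (W : (G.deleteEdges F).Walk a b), t.Sub a u → ¬ t.Sub b u →
      ∃ x y, (G.deleteEdges F).Adj x y ∧ t.Sub x u ∧ ¬ t.Sub y u := by
    intro a b W
    induction W with
    | nil => intro h1 h2; exact absurd h1 h2
    | @cons a c b hadj q ih =>
      intro h1 h2
      by_cases hc : t.Sub c u
      · exact ih hc h2
      · exact ⟨a, c, hadj, h1, hc⟩
  obtain ⟨x, y, h1, h2, h3⟩ := key u d W (t.sub_refl u) (fun h => hu (t.sub_d h))
  rw [deleteEdges_adj] at h1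
  refine t.esc_exists (q := (x, y)) hu ⟨h1.1, h2, h3, ?_⟩
  rintro ⟨e1, e2⟩
  simp only at e1 e2
  apply h1.2
  rw [e1, e2]
  exact hf

theorem del_up (hF : F.Subsingleton) {N : ℕ} (hN : ∀ v, t.h v < N)
    (hnx : ∀ v q, t.esc v = some q → t.Nxt v q (nx v)) (a b : V)
    (h : G.Adj a b) (hl : s(a, b) ∉ F) (hd : ¬ t.Down a b)
    (hr : (G.deleteEdges F).Reachable b d) : Del (t.pat nx) F a b := by
  induction hn : t.h b generalizing a b with
  | zero =>
    by_cases hb : b = d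
    · subst hb; exact del_dest _ h hl
    · have := t.ph b hb; omega
  | succ n ih =>
    by_cases hb : b = d
    · subst hb; exact del_dest _ h hl
    have hph := t.ph b hb
    by_cases hf : s(b, t.p b) ∈ F
    · obtain ⟨q, hq⟩ := t.exists_esc hb hf hr
      have hS : t.S F b := ⟨b, hb, hf, t.sub_refl b⟩
      have hSq := t.esc_not_S hF hb hf hq
      obtain ⟨h1, h2, _⟩ := t.nx_step hF hnx hS hq hSq
      exact del_cons h hl (t.rule_nx nx hb (Or.inr hf) hq h1 h2) (t.del_nx hF hN hnx hS hq hSq)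
    · have hadj : (G.deleteEdges F).Adj b (t.p b) := by
        rw [deleteEdges_adj]; exact ⟨t.padj b hb, hf⟩
      exact del_cons h hl (t.rule_up nx hb hd hf)
        (ih b (t.p b) (t.padj b hb) hf (t.up_not_down hb)
          (hadj.symm.reachable.trans hr) (by omega))

theorem deliver (hF : F.Subsingleton) {N : ℕ} (hN : ∀ v, t.h v < N)
    (hnx : ∀ v q, t.esc v = some q → t.Nxt v q (nx v)) (i : V)
    (hr : (G.deleteEdges F).Reachable i d) : HasFwdPathTo G d (t.pat nx) F i := by
  have fin : ∀ b, Del (t.pat nx) F i b → HasFwdPathTo G d (t.pat nx) F i := by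
    rintro b ⟨p, n, h1, h2, _, h3⟩
    exact ⟨p, n + 1, h1, h2, h3⟩
  by_cases hi : i = d
  · exact ⟨fun _ => i, 0, ⟨fun k hk => by omega, fun k hk => by omega⟩, rfl, hi⟩
  by_cases hf : s(i, t.p i) ∈ F
  · obtain ⟨q, hq⟩ := t.exists_esc hi hf hr
    exact fin _ (t.del_nx hF hN hnx ⟨i, hi, hf, t.sub_refl i⟩ hq (t.esc_not_S hF hi hf hq))
  · have hadj : (G.deleteEdges F).Adj i (t.p i) := by
      rw [deleteEdges_adj]; exact ⟨t.padj i hi, hf⟩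
    exact fin _ (t.del_up hF hN hnx i (t.p i) (t.padj i hi) hf (t.up_not_down hi)
      (hadj.symm.reachable.trans hr))

end deliver

end RTree

/-- For every network (finite connected simple undirected graph with a distinguished
destination vertex `d`), there exists a 1-resilient forwarding pattern. -/
theorem stmt_0 {V : Type*} [Fintype V] (G : SimpleGraph V) (d : V)
    (hG : G.Connected) :
    ∃ fp : FwdPattern G d, IsResilient G d fp 1 := by
  obtain ⟨t⟩ := exists_rtree G d hG
  obtain ⟨nx, hnx⟩ := t.exists_nxt
  have hN : ∀ v, t.h v < (Finset.univ.sup t.h) + 1 := fun v =>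
    Nat.lt_succ_of_le (Finset.le_sup (Finset.mem_univ v))
  refine ⟨t.pat nx, fun F _ hF => ?_⟩
  have hF' : (F : Set (Sym2 V)).Subsingleton := by
    intro a ha b hb
    exact Finset.card_le_one.mp hF a ha b hb
  exact ⟨t.deliver hF' hN hnx, t.loop_free hF' hN hnx⟩
end

section
/- Let f be a perfectly resilient forwarding pattern on a finite simple undirected graph G = (V,E) with destination d, let F ⊆ E be a failure set, and let {u,v} ∈ E \ F with u ≠ d and v ≠ d. Let F' = F ∪ (E_u \ {{u,v}}) be the failure set that additionally fails every edge incident to u other than {u,v}. If v has a path to d in H^{F'}, then f_v({u,v}, E_v \ F) ≠ {u,v}; that is, v must not send a packet that arrived from u back to u. -/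
open SimpleGraph

/-- Lemma 1: for a perfectly resilient forwarding pattern, if the edge `{u,v}` is live
under `F` (with `u ≠ d`, `v ≠ d`) and `v` still has a path to `d` after additionally
failing every edge incident to `u` other than `{u,v}`, then `v` must not send a packet
arriving from `u` back to `u`. -/
theorem stmt_3 {V : Type*} [Fintype V] (G : SimpleGraph V) (d : V)
    (fp : FwdPattern G d) (hfp : PerfectlyResilient G d fp)
    (F : Set (Sym2 V)) (hF : F ⊆ G.edgeSet)
    (u v : V) (huv : G.Adj u v) (huvF : s(u, v) ∉ F) (hu : u ≠ d) (hv : v ≠ d)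
    (hreach : (G.deleteEdges (F ∪ (G.incidenceSet u \ {s(u, v)}))).Reachable v d) :
    fp.rule v s(u, v) (G.incidenceSet v \ F) ≠ some s(u, v) := by
  intro hrule
  set F' := F ∪ (G.incidenceSet u \ {s(u, v)}) with hF'
  have hsub : F' ⊆ G.edgeSet := by
    rintro e (he | he)
    · exact hF he
    · exact he.1.1
  have huv' : s(u, v) ∉ F' := by
    rintro (h | h)
    · exact huvF h
    · exact h.2 rfl
  have hne : u ≠ v := huv.ne
  -- the live edges at `v` do not change
  have hlive : G.incidenceSet v \ F' = G.incidenceSet v \ F := by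
    ext e
    constructor
    · rintro ⟨h1, h2⟩
      exact ⟨h1, fun h => h2 (Or.inl h)⟩
    · rintro ⟨h1, h2⟩
      refine ⟨h1, ?_⟩
      rintro (h | h)
      · exact h2 h
      · exact h.2 ((Sym2.mem_and_mem_iff hne).1 ⟨h.1.2, h1.2⟩)
  -- under the larger failure set, `v` is the only neighbour of `u`
  have hnbr : ∀ w, (G.deleteEdges F').Adj u w → w = v := by
    intro w hw
    rw [SimpleGraph.deleteEdges_adj] at hw
    by_contra hwv
    refine hw.2 (Or.inr ⟨⟨hw.1, Sym2.mem_mk_left u w⟩, ?_⟩)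
    intro h
    exact hwv (Sym2.congr_right.1 h)
  have hadj : (G.deleteEdges F').Adj u v := by
    rw [SimpleGraph.deleteEdges_adj]
    exact ⟨huv, huv'⟩
  obtain ⟨hres, hloop⟩ := hfp F' hsub
  obtain ⟨p, n, hp, h0, hn⟩ := hres u (hadj.reachable.trans hreach)
  have n0 : n ≠ 0 := by
    rintro rfl
    exact hu (h0.symm.trans hn)
  have h1 : p 1 = v := by
    have := hp.1 0 (by omega)
    rw [h0] at this
    exact hnbr _ this
  have n1 : n ≠ 1 := by
    rintro rfl
    exact hv (h1.symm.trans hn)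
  have h2 : p 2 = u := by
    have := hp.2 0 (by omega)
    simp only [Nat.zero_add, h0, h1, hlive, hrule, Option.some.injEq] at this
    rw [Sym2.eq_swap] at this
    exact (Sym2.congr_right.1 this).symm
  have n2 : n ≠ 2 := by
    rintro rfl
    exact hu (h2.symm.trans hn)
  have h3 : p 3 = v := by
    have := hp.1 2 (by omega)
    rw [h2] at this
    exact hnbr _ this
  exact hloop p n hp ⟨0, 2, by omega, by omega, h0.trans h2.symm, h1.trans h3.symm⟩
end

section
/- There exists a finite connected simple undirected graph G = (V,E) with a destination vertex d for which no forwarding pattern is perfectly resilient; that is, for every forwarding pattern f on G there is a failure set F ⊆ E and a vertex i in the connected component of d in H^F such that either i has no forwarding path to d in H^F, or some forwarding path in H^F contains a loop. -/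
open SimpleGraph

/-- On `K₄` with destination `3`, if only the path `a - b - c - 3` is alive, then the vertex `b`
must forward a packet coming from `a` to `c`. -/
lemma path_forced (fp : FwdPattern (⊤ : SimpleGraph (Fin 4)) 3)
    (H : ∀ F : Set (Sym2 (Fin 4)), F ⊆ (⊤ : SimpleGraph (Fin 4)).edgeSet →
      ResilientUnder ⊤ 3 fp F)
    (a b c : Fin 4) (hab : a ≠ b) (hac : a ≠ c) (hbc : b ≠ c)
    (ha : a ≠ 3) (hb : b ≠ 3) (hc : c ≠ 3) :
    fp.rule b s(a, b) {s(a, b), s(b, c)} = some s(b, c) := by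
  obtain ⟨h1, h2⟩ := H ((⊤ : SimpleGraph (Fin 4)).edgeSet \ {s(a, b), s(b, c), s(c, 3)})
    Set.sdiff_subset
  have adj : ∀ x y, ((⊤ : SimpleGraph (Fin 4)).deleteEdges
      ((⊤ : SimpleGraph (Fin 4)).edgeSet \ {s(a, b), s(b, c), s(c, 3)})).Adj x y ↔
      x ≠ y ∧ (s(x, y) = s(a, b) ∨ s(x, y) = s(b, c) ∨ s(x, y) = s(c, 3)) := by
    intro x y
    simp only [deleteEdges_adj, top_adj, Set.mem_diff, mem_edgeSet, Set.mem_insert_iff,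
      Set.mem_singleton_iff]
    tauto
  have inc : (⊤ : SimpleGraph (Fin 4)).incidenceSet b \
      ((⊤ : SimpleGraph (Fin 4)).edgeSet \ {s(a, b), s(b, c), s(c, 3)}) =
      {s(a, b), s(b, c)} := by
    ext e
    induction e using Sym2.ind with
    | _ x y =>
      simp only [incidenceSet, Set.mem_diff, Set.mem_setOf_eq, mem_edgeSet, top_adj,
        Set.mem_insert_iff, Set.mem_singleton_iff, Sym2.mem_iff, Sym2.eq_iff]
      grind
  have hreach : ((⊤ : SimpleGraph (Fin 4)).deleteEdges
      ((⊤ : SimpleGraph (Fin 4)).edgeSet \ {s(a, b), s(b, c), s(c, 3)})).Reachable a 3 := by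
    have e1 := (adj a b).2 ⟨hab, Or.inl rfl⟩
    have e2 := (adj b c).2 ⟨hbc, Or.inr (Or.inl rfl)⟩
    have e3 := (adj c 3).2 ⟨hc, Or.inr (Or.inr rfl)⟩
    exact e1.reachable.trans (e2.reachable.trans e3.reachable)
  obtain ⟨p, n, hp, p0, pn⟩ := h1 a hreach
  have hloop := h2 p n hp
  obtain ⟨hadj, hrule⟩ := hp
  simp only [adj, Sym2.eq_iff] at hadj
  have n0 : n ≠ 0 := by rintro rfl; exact ha (p0.symm.trans pn)
  have a0 := hadj 0 (by omega)
  have p1 : p 1 = b := by grind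
  have n1 : n ≠ 1 := by rintro rfl; exact hb (p1.symm.trans pn)
  have a1 := hadj 1 (by omega)
  have r := hrule 0 (by omega)
  simp only [Nat.zero_add, p0, p1] at r a1
  rw [inc] at r
  have p2 : p 2 = c ∨ p 2 = a := by grind
  rcases p2 with p2 | p2
  · rwa [p2] at r
  · exfalso
    have n2 : n ≠ 2 := by rintro rfl; exact ha (p2.symm.trans pn)
    have a2 := hadj 2 (by omega)
    have p3 : p 3 = b := by grind
    exact hloop ⟨0, 2, by omega, by omega, by rw [p0, p2], by rw [p1, p3]⟩

/-- There is a finite connected simple graph with destination `d` on which no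
forwarding pattern is perfectly resilient: for every forwarding pattern there is a
failure set `F` and a vertex `i` in the component of `d` in `H^F` such that either `i`
has no forwarding path to `d` in `H^F`, or some forwarding path in `H^F` has a loop. -/
theorem stmt_5 :
    ∃ (n : ℕ) (G : SimpleGraph (Fin n)) (d : Fin n), G.Connected ∧
      ∀ fp : FwdPattern G d, ∃ F : Set (Sym2 (Fin n)), F ⊆ G.edgeSet ∧
        ∃ i, (G.deleteEdges F).Reachable i d ∧
          (¬ HasFwdPathTo G d fp F i ∨
           ∃ p m, IsFwdPath G d fp F p m ∧ RepeatsDirEdge p m) := by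
  refine ⟨4, ⊤, 3, connected_top, fun fp => ?_⟩
  by_contra hcon
  push Not at hcon
  have H : ∀ F : Set (Sym2 (Fin 4)), F ⊆ (⊤ : SimpleGraph (Fin 4)).edgeSet →
      ResilientUnder ⊤ 3 fp F := fun F hF =>
    ⟨fun i hi => (hcon F hF i hi).1, (hcon F hF 3 (Reachable.refl _)).2⟩
  have r0 := path_forced fp H 2 0 1 (by decide) (by decide) (by decide) (by decide) (by decide)
    (by decide)
  have r1 := path_forced fp H 0 1 2 (by decide) (by decide) (by decide) (by decide) (by decide)
    (by decide)
  have r2 := path_forced fp H 1 2 0 (by decide) (by decide) (by decide) (by decide) (by decide)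
    (by decide)
  have inc : ∀ a b c : Fin 4, a ≠ b → a ≠ c → b ≠ c → a ≠ 3 → b ≠ 3 → c ≠ 3 →
      (⊤ : SimpleGraph (Fin 4)).incidenceSet b \ (⊤ : SimpleGraph (Fin 4)).incidenceSet 3 =
      {s(a, b), s(b, c)} := by
    intro a b c hab hac hbc ha hb hc
    ext e
    induction e using Sym2.ind with
    | _ x y =>
      simp only [incidenceSet, Set.mem_diff, Set.mem_setOf_eq, mem_edgeSet, top_adj,
        Set.mem_insert_iff, Set.mem_singleton_iff, Sym2.mem_iff, Sym2.eq_iff]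
      revert a b c x y
      decide
  -- with all edges at the destination failed, the packet circles around the triangle `0, 1, 2`
  refine (H ((⊤ : SimpleGraph (Fin 4)).incidenceSet 3) (incidenceSet_subset _ _)).2
    (fun k => if k = 0 ∨ k = 3 then 0 else if k = 1 ∨ k = 4 then 1 else 2) 4
    ⟨fun k hk => ?_, fun k hk => ?_⟩ ⟨0, 3, by omega, by omega, by simp, by simp⟩
  · simp only [deleteEdges_adj, top_adj, incidenceSet, Set.mem_setOf_eq, mem_edgeSet, Sym2.mem_iff]
    interval_cases k <;> simp <;> decide
  · have hk' : k < 3 := by omega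
    interval_cases k
    · simpa [inc 0 1 2] using r1
    · simpa [inc 1 2 0] using r2
    · simpa [inc 2 0 1] using r0
end

section
/- Every finite connected simple undirected graph G = (V,E) with a distinguished vertex d admits an acyclic orientation with unique sink d: an assignment of a direction to every edge of G such that the resulting directed graph has no directed cycle and d is the only vertex with no outgoing edge. -/
open SimpleGraph

/-- `r` is an acyclic orientation of `G` with unique sink `d`: every edge of `G` gets
exactly one direction, there is no directed cycle, `d` has no outgoing edge, and every
other vertex has an outgoing edge. -/
structure IsAcyclicOrientation {V : Type*} (G : SimpleGraph V) (d : V)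
    (r : V → V → Prop) : Prop where
  adj_of_dir : ∀ u v, r u v → G.Adj u v
  dir_total : ∀ u v, G.Adj u v → (r u v ↔ ¬ r v u)
  acyclic : ∀ v, ¬ Relation.TransGen r v v
  sink : ∀ v, ¬ r d v
  sink_unique : ∀ v, v ≠ d → ∃ w, r v w

/-- `p 0, ..., p n` is a directed walk in the digraph given by `r`. -/
def IsDirWalk {V : Type*} (r : V → V → Prop) (p : ℕ → V) (n : ℕ) : Prop :=
  ∀ k, k < n → r (p k) (p (k + 1))


/-- Every finite connected simple graph with a distinguished vertex `d` admits an
acyclic orientation with unique sink `d`. -/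
theorem stmt_6 {V : Type*} [Fintype V] (G : SimpleGraph V) (d : V)
    (hG : G.Connected) :
    ∃ r : V → V → Prop, IsAcyclicOrientation G d r := by
  classical
  let f : V → ℕ ×ₗ Fin (Fintype.card V) :=
    fun v => toLex (G.dist d v, Fintype.equivFin V v)
  have hinj : Function.Injective f := by
    intro a b h
    have h2 : (G.dist d a, Fintype.equivFin V a) = (G.dist d b, Fintype.equivFin V b) :=
      toLex.injective h
    exact (Fintype.equivFin V).injective (Prod.ext_iff.mp h2).2
  refine ⟨fun u v => G.Adj u v ∧ f v < f u, ?_, ?_, ?_, ?_, ?_⟩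
  · exact fun u v h => h.1
  · intro u v h
    have hne : f u ≠ f v := fun e => h.ne (hinj e)
    constructor
    · exact fun h1 h2 => lt_asymm h1.2 h2.2
    · intro h1
      refine ⟨h, ?_⟩
      rcases lt_or_gt_of_ne hne with h3 | h3
      · exact absurd ⟨h.symm, h3⟩ h1
      · exact h3
  · have key : ∀ u v, Relation.TransGen (fun u v => G.Adj u v ∧ f v < f u) u v → f v < f u := by
      intro u v h
      induction h with
      | single h => exact h.2
      | tail _ h ih => exact h.2.trans ih
    exact fun v h => lt_irrefl _ (key v v h)
  · rintro v ⟨hadj, hlt⟩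
    have h1 := Prod.Lex.toLex_lt_toLex.mp hlt
    have h2 : 0 < G.dist d v := hG.pos_dist_of_ne hadj.ne
    have h3 : G.dist d d = 0 := SimpleGraph.dist_self
    simp only [h3] at h1
    omega
  · intro v hv
    obtain ⟨p, hp⟩ := hG.exists_walk_length_eq_dist v d
    cases p with
    | nil => exact absurd rfl hv
    | cons h q =>
      rename_i w
      refine ⟨w, h, Prod.Lex.toLex_lt_toLex.mpr (Or.inl ?_)⟩
      have h1 := SimpleGraph.dist_le q
      rw [SimpleGraph.Walk.length_cons] at hp
      show G.dist d w < G.dist d v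
      rw [SimpleGraph.dist_comm, SimpleGraph.dist_comm (u := d) (v := v)]
      omega
end
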